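/- In R = MvPolynomial (Fin 8) ℤ, the second elementary symmetric function of the multiset W((2,1,1), 8) of weights of semistandard Young tableaux of shape (2,1,1) with entries in {0,…,7} is congruent to 156·e₂ modulo the ideal generated by e₁; equivalently, c₂(γ₈^{(2,1,1)}) = 156·c₂(γ₈), the Table 1 entry for the weight α₁+α₃ of SL₈/μ₂. -/

import Mathlib

open MvPolynomial

open scoped Classical in
/-- The multiset `W(lam, n)` of weights of semistandard Young tableaux of shape
`lam` (a list of row lengths) with entries in `{0, …, n-1}`: a tableau assigns
to each cell `(i, j)` of the Young diagram of `lam` an entry in `Fin n`, weakly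
increasing along rows and strictly increasing down columns; its weight is the
sum `∑_{(i,j) ∈ lam} X_{T(i,j)}`. -/
noncomputable def ssytWeights (lam : List ℕ) (n : ℕ) :
    Multiset (MvPolynomial (Fin n) ℤ) :=
  ((Finset.univ : Finset ((i : Fin lam.length) → Fin (lam.get i) → Fin n)).filter
      (fun T =>
        (∀ (i : Fin lam.length) (j j' : Fin (lam.get i)), (j : ℕ) ≤ (j' : ℕ) → T i j ≤ T i j') ∧
        (∀ (i i' : Fin lam.length), (i : ℕ) < (i' : ℕ) →
          ∀ (j : Fin (lam.get i')) (hj : (j : ℕ) < lam.get i), T i ⟨j, hj⟩ < T i' j))).val.map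
    (fun T => ∑ i, ∑ j, MvPolynomial.X (T i j))

/-- Newton's identity in degree two for the elementary symmetric functions of a multiset. -/
theorem Multiset.two_mul_esymm_two {R : Type*} [CommRing R] (s : Multiset R) :
    2 * s.esymm 2 = s.sum ^ 2 - (s.map (· ^ 2)).sum := by
  induction s using Multiset.induction with
  | empty => simp [Multiset.esymm, Multiset.powersetCard_zero_right]
  | cons a s ih =>
    have h : (a ::ₘ s).esymm 2 = s.esymm 2 + a * s.sum := by
      simp [Multiset.esymm, Multiset.powersetCard_cons, Multiset.powersetCard_one,
        Multiset.map_map]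
      simpa using Multiset.sum_map_mul_left (a := a) (s := s) (f := id)
    rw [h, mul_add, ih, Multiset.sum_cons, Multiset.map_cons, Multiset.sum_cons]
    ring

/-- If the weights `∑ i, m t i • X i` have first moments `k` and second moments
`b + (a if i = j)`, then the second elementary symmetric function of the weights is
`a • e₂` modulo `e₁`, up to a factor of two. -/
theorem two_mul_esymm_two_weights {ι σ : Type*} [Fintype σ] [DecidableEq σ] (S : Finset ι)
    (m : ι → σ → ℕ) (a b k : ℕ) (h₁ : ∀ i, ∑ t ∈ S, m t i = k)
    (h₂ : ∀ i j, ∑ t ∈ S, m t i * m t j = b + if i = j then a else 0) :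
    2 * (S.val.map fun t => ∑ i, (m t i : MvPolynomial σ ℤ) * X i).esymm 2 =
      2 * (a * esymm σ ℤ 2) + ((k : MvPolynomial σ ℤ) ^ 2 - a - b) * esymm σ ℤ 1 ^ 2 := by
  have hp : 2 * esymm σ ℤ 2 = (∑ i, X i) ^ 2 - ∑ i, X i ^ 2 := by
    rw [esymm_eq_multiset_esymm, Multiset.two_mul_esymm_two, Multiset.map_map]
    rfl
  have hs : ∑ t ∈ S, ∑ i, (m t i : MvPolynomial σ ℤ) * X i =
      (k : MvPolynomial σ ℤ) * ∑ i, X i := by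
    rw [Finset.sum_comm, Finset.mul_sum]
    refine Finset.sum_congr rfl fun i _ => ?_
    rw [← Finset.sum_mul, ← Nat.cast_sum, h₁]
  have hq : ∑ t ∈ S, (∑ i, (m t i : MvPolynomial σ ℤ) * X i) ^ 2 =
      (b : MvPolynomial σ ℤ) * (∑ i, X i) ^ 2 + (a : MvPolynomial σ ℤ) * ∑ i, X i ^ 2 := by
    calc
      _ = ∑ i, ∑ j, ((∑ t ∈ S, m t i * m t j : ℕ) : MvPolynomial σ ℤ) * (X i * X j) := by
        simp only [sq, Finset.sum_mul_sum]
        rw [Finset.sum_comm]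
        refine Finset.sum_congr rfl fun i _ => ?_
        rw [Finset.sum_comm]
        refine Finset.sum_congr rfl fun j _ => ?_
        rw [Nat.cast_sum, Finset.sum_mul]
        refine Finset.sum_congr rfl fun t _ => ?_
        push_cast
        ring
      _ = _ := by
        simp only [sq, Finset.sum_mul_sum]
        simp [h₂, add_mul, Finset.sum_add_distrib, Finset.mul_sum]
  rw [Multiset.two_mul_esymm_two, Multiset.map_map, mul_left_comm, hp, esymm_one]
  change (∑ t ∈ S, _) ^ 2 - ∑ t ∈ S, _ ^ 2 = _
  rw [hs, hq]
  ring

/-- The tableaux of shape `[2, 1, 1]`, as quadruples `(a, b, c, d)` with first row `a, b` and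
first column `a, c, d`. -/
def ssytTwoOneOne (n : ℕ) : Finset (Fin n × Fin n × Fin n × Fin n) :=
  Finset.univ.filter fun t => t.1 ≤ t.2.1 ∧ t.1 < t.2.2.1 ∧ t.2.2.1 < t.2.2.2

/-- The number of occurrences of an entry in a quadruple. -/
def entryMult {n : ℕ} (t : Fin n × Fin n × Fin n × Fin n) (i : Fin n) : ℕ :=
  (if t.1 = i then 1 else 0) + (if t.2.1 = i then 1 else 0) +
    (if t.2.2.1 = i then 1 else 0) + (if t.2.2.2 = i then 1 else 0)

theorem sum_entryMult_mul_X {n : ℕ} (t : Fin n × Fin n × Fin n × Fin n) :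
    ∑ i, (entryMult t i : MvPolynomial (Fin n) ℤ) * X i =
      X t.1 + X t.2.1 + X t.2.2.1 + X t.2.2.2 := by
  simp [entryMult, add_mul, Finset.sum_add_distrib]

theorem ssytWeights_two_one_one (n : ℕ) :
    ssytWeights [2, 1, 1] n =
      (ssytTwoOneOne n).val.map
        fun t => ∑ i, (entryMult t i : MvPolynomial (Fin n) ℤ) * X i := by
  classical
  simp only [sum_entryMult_mul_X]
  unfold ssytWeights
  refine Multiset.map_eq_map_of_bij_of_nodup _ _ (Finset.nodup _) (Finset.nodup _)
    (fun T _ => (T (0 : Fin 3) (0 : Fin 2), T (0 : Fin 3) (1 : Fin 2),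
      T (1 : Fin 3) (0 : Fin 1), T (2 : Fin 3) (0 : Fin 1))) ?_ ?_ ?_ ?_
  · intro T hT
    obtain ⟨hr, hc⟩ := (Finset.mem_filter.1 hT).2
    refine Finset.mem_filter.2 ⟨Finset.mem_univ _, ?_, ?_, ?_⟩
    · exact hr (0 : Fin 3) (0 : Fin 2) (1 : Fin 2) (by decide)
    · exact hc (0 : Fin 3) (1 : Fin 3) (by decide) (0 : Fin 1) (by decide)
    · exact hc (1 : Fin 3) (2 : Fin 3) (by decide) (0 : Fin 1) (by decide)
  · intro T _ T' _ h
    simp only [Prod.mk.injEq] at h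
    obtain ⟨h1, h2, h3, h4⟩ := h
    funext i j
    change Fin 3 at i
    fin_cases i
    · change Fin 2 at j
      fin_cases j
      · exact h1
      · exact h2
    · change Fin 1 at j
      fin_cases j
      exact h3
    · change Fin 1 at j
      fin_cases j
      exact h4
  · rintro ⟨a, b, c, d⟩ ht
    obtain ⟨h1, h2, h3⟩ := (Finset.mem_filter.1 ht).2
    dsimp only at h1 h2 h3
    refine ⟨fun i j => if (i : ℕ) = 0 then (if (j : ℕ) = 0 then a else b)
      else if (i : ℕ) = 1 then c else d, ?_, rfl⟩
    refine Finset.mem_filter.2 ⟨Finset.mem_univ _, ?_, ?_⟩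
    · intro i j j' hj
      change Fin 3 at i
      fin_cases i
      · change Fin 2 at j j'
        fin_cases j <;> fin_cases j' <;> simp_all
      · simp
      · simp
    · intro i i' hi j hj
      change Fin 3 at i i'
      have h4 := h2.trans h3
      fin_cases i <;> fin_cases i' <;> first
        | exact absurd hi (by decide)
        | (change Fin 1 at j
           fin_cases j
           simp_all)
  · intro T _
    change ∑ i : Fin 3, _ = _
    rw [Fin.sum_univ_three]
    change (∑ j : Fin 2, _) + (∑ j : Fin 1, _) + (∑ j : Fin 1, _) = _
    rw [Fin.sum_univ_two, Fin.sum_univ_one, Fin.sum_univ_one]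

theorem sum_entryMult_eight (i : Fin 8) : ∑ t ∈ ssytTwoOneOne 8, entryMult t i = 189 := by
  revert i
  decide +kernel

theorem sum_entryMult_mul_entryMult_eight (i j : Fin 8) :
    ∑ t ∈ ssytTwoOneOne 8, entryMult t i * entryMult t j = 75 + if i = j then 156 else 0 := by
  revert i j
  decide +kernel

/-- `c₂(γ8^[2, 1, 1]) = 156·c₂(γ8)`: the second elementary symmetric function of
the multiset of weights of semistandard Young tableaux of shape `[2, 1, 1]` with
entries in `{0, …, 7}` is congruent to `156·e₂` modulo the ideal generated
by `e₁`. -/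
theorem c2_ssyt_stmt7 :
    Multiset.esymm (ssytWeights [2, 1, 1] 8) 2 - 156 * esymm (Fin 8) ℤ 2
      ∈ Ideal.span {esymm (Fin 8) ℤ 1} := by
  have h := two_mul_esymm_two_weights (ssytTwoOneOne 8) entryMult 156 75 189
    sum_entryMult_eight sum_entryMult_mul_entryMult_eight
  rw [← ssytWeights_two_one_one] at h
  refine Ideal.mem_span_singleton'.2 ⟨17745 * esymm (Fin 8) ℤ 1, ?_⟩
  refine mul_left_cancel₀ (two_ne_zero (α := MvPolynomial (Fin 8) ℤ)) ?_
  push_cast at h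
  linear_combination -h
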